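/- A lightcone framed curve (γ,ℓ⁺,ℓ⁻) : I → ℝ³₁ × Δ₄ with lightcone curvature (κ₁,κ₂,κ₃,α,β) is an (ℓ⁺,ℓ̄⁺)-Bertrand lightcone framed curve if and only if there exist smooth functions λ, k : I → ℝ with λ ≢ 0 such that k(t)β(t) = λ(t)κ₃(t) for all t ∈ I. -/

import Mathlib

open Matrix

noncomputable section

/-- The Minkowski pseudo-scalar product on `ℝ³`:
`⟨x,y⟩ = −x₁y₁ + x₂y₂ + x₃y₃`. -/
def mdot (x y : Fin 3 → ℝ) : ℝ := -(x 0 * y 0) + x 1 * y 1 + x 2 * y 2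

/-- The pseudo vector product `x ∧ y` on Minkowski `ℝ³`, i.e. the determinant of the
matrix with rows `(−e₁, e₂, e₃)`, `x`, `y`. -/
def mcross (x y : Fin 3 → ℝ) : Fin 3 → ℝ :=
  ![-(x 1 * y 2 - x 2 * y 1), x 2 * y 0 - x 0 * y 2, x 0 * y 1 - x 1 * y 0]

/-- The (punctured) lightcone `LC* = {x ≠ 0 : ⟨x,x⟩ = 0}`. -/
def LCstar (x : Fin 3 → ℝ) : Prop := x ≠ 0 ∧ mdot x x = 0

/-- Membership in `Δ₄ = {(v,w) ∈ LC* × LC* : ⟨v,w⟩ = −2}`. -/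
def MemDelta4 (v w : Fin 3 → ℝ) : Prop := LCstar v ∧ LCstar w ∧ mdot v w = -2

/-- `n(t) = −(1/2) ℓ⁺(t) ∧ ℓ⁻(t)`. -/
def lcn (lp lm : ℝ → Fin 3 → ℝ) : ℝ → Fin 3 → ℝ :=
  fun t => (-(1/2) : ℝ) • mcross (lp t) (lm t)

/-- Smoothness (on `I`) of a real valued function. -/
def Smooth1 (I : Set ℝ) (f : ℝ → ℝ) : Prop := ContDiffOn ℝ (⊤ : ℕ∞) f I

/-- Smoothness (on `I`) of an `ℝ³`-valued function. -/
def Smooth3 (I : Set ℝ) (f : ℝ → Fin 3 → ℝ) : Prop := ContDiffOn ℝ (⊤ : ℕ∞) f I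

/-- `λ ≢ 0` : the set where `λ` is non-zero is dense in `I`. -/
def NotIdentZero (I : Set ℝ) (f : ℝ → ℝ) : Prop :=
  I ⊆ closure {t | t ∈ I ∧ f t ≠ 0}

/-- A lightcone framed curve `(γ, ℓ⁺, ℓ⁻) : I → ℝ³₁ × Δ₄`. -/
structure IsLightconeFramedCurve (I : Set ℝ) (γ lp lm : ℝ → Fin 3 → ℝ) : Prop where
  smooth_base : Smooth3 I γ
  smooth_lp : Smooth3 I lp
  smooth_lm : Smooth3 I lm
  delta4 : ∀ t ∈ I, MemDelta4 (lp t) (lm t)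
  exists_coeffs : ∃ α β : ℝ → ℝ, Smooth1 I α ∧ Smooth1 I β ∧
    ∀ t ∈ I, deriv γ t = α t • lp t + β t • lm t

/-- `(κ₁, κ₂, κ₃, α, β)` is the lightcone curvature of the lightcone framed curve
`(γ, ℓ⁺, ℓ⁻)`. -/
structure HasLightconeCurvature (I : Set ℝ) (γ lp lm : ℝ → Fin 3 → ℝ)
    (κ₁ κ₂ κ₃ α β : ℝ → ℝ) : Prop where
  smooth_κ₁ : Smooth1 I κ₁
  smooth_κ₂ : Smooth1 I κ₂
  smooth_κ₃ : Smooth1 I κ₃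
  smooth_α : Smooth1 I α
  smooth_β : Smooth1 I β
  deriv_lp : ∀ t ∈ I, deriv lp t = κ₁ t • lp t + (2 * κ₃ t) • lcn lp lm t
  deriv_lm : ∀ t ∈ I, deriv lm t = (-κ₁ t) • lm t + (2 * κ₂ t) • lcn lp lm t
  deriv_n : ∀ t ∈ I, deriv (lcn lp lm) t = κ₂ t • lp t + κ₃ t • lm t
  deriv_base : ∀ t ∈ I, deriv γ t = α t • lp t + β t • lm t

/-- The vector field `ℓ⁺` built from a lightcone frame. -/
def fieldLp (lp lm : ℝ → Fin 3 → ℝ) : ℝ → Fin 3 → ℝ := fun t => lp t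
/-- The vector field `ℓ⁻` built from a lightcone frame. -/
def fieldLm (lp lm : ℝ → Fin 3 → ℝ) : ℝ → Fin 3 → ℝ := fun t => lm t
/-- `nᵀ = (ℓ⁺ + ℓ⁻)/2`. -/
def fieldNT (lp lm : ℝ → Fin 3 → ℝ) : ℝ → Fin 3 → ℝ := fun t => (1/2 : ℝ) • (lp t + lm t)
/-- `nˢ = (ℓ⁺ − ℓ⁻)/2`. -/
def fieldNS (lp lm : ℝ → Fin 3 → ℝ) : ℝ → Fin 3 → ℝ := fun t => (1/2 : ℝ) • (lp t - lm t)
/-- `n = −(1/2) ℓ⁺ ∧ ℓ⁻`. -/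
def fieldN (lp lm : ℝ → Fin 3 → ℝ) : ℝ → Fin 3 → ℝ := lcn lp lm
/-- `ℓ̃⁺ = nᵀ + n`. -/
def fieldLtp (lp lm : ℝ → Fin 3 → ℝ) : ℝ → Fin 3 → ℝ :=
  fun t => fieldNT lp lm t + fieldN lp lm t
/-- `ℓ̃⁻ = nᵀ − n`. -/
def fieldLtm (lp lm : ℝ → Fin 3 → ℝ) : ℝ → Fin 3 → ℝ :=
  fun t => fieldNT lp lm t - fieldN lp lm t

/-- `(γ,ℓ⁺,ℓ⁻)` and `(γ̄,ℓ̄⁺,ℓ̄⁻)` are `(v,w̄)`-mates. -/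
def AreMates (I : Set ℝ)
    (v w : (ℝ → Fin 3 → ℝ) → (ℝ → Fin 3 → ℝ) → ℝ → Fin 3 → ℝ)
    (γ lp lm γ' lp' lm' : ℝ → Fin 3 → ℝ) : Prop :=
  IsLightconeFramedCurve I γ lp lm ∧ IsLightconeFramedCurve I γ' lp' lm' ∧
  ∃ lam : ℝ → ℝ, Smooth1 I lam ∧ NotIdentZero I lam ∧
    (∀ t ∈ I, γ' t = γ t + lam t • v lp lm t) ∧
    (∀ t ∈ I, v lp lm t = w lp' lm' t)

/-- `(γ,ℓ⁺,ℓ⁻)` is a `(v,w̄)`-Bertrand lightcone framed curve. -/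
def IsBertrand (I : Set ℝ)
    (v w : (ℝ → Fin 3 → ℝ) → (ℝ → Fin 3 → ℝ) → ℝ → Fin 3 → ℝ)
    (γ lp lm : ℝ → Fin 3 → ℝ) : Prop :=
  ∃ γ' lp' lm' : ℝ → Fin 3 → ℝ, AreMates I v w γ lp lm γ' lp' lm'

theorem mdot_add_left (x y z : Fin 3 → ℝ) : mdot (x + y) z = mdot x z + mdot y z := by
  simp only [mdot, Pi.add_apply]; ring

theorem mdot_smul_left (a : ℝ) (x z : Fin 3 → ℝ) : mdot (a • x) z = a * mdot x z := by
  simp only [mdot, Pi.smul_apply, smul_eq_mul]; ring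

theorem mdot_comm (x y : Fin 3 → ℝ) : mdot x y = mdot y x := by
  simp only [mdot]; ring

theorem mdot_zero_left (x : Fin 3 → ℝ) : mdot 0 x = 0 := by
  simp [mdot]

theorem mdot_mcross_left (x y : Fin 3 → ℝ) : mdot (mcross x y) x = 0 := by
  simp [mdot, mcross]; ring

theorem mdot_mcross_right (x y : Fin 3 → ℝ) : mdot (mcross x y) y = 0 := by
  simp [mdot, mcross]; ring

theorem mdot_mcross_self (x y : Fin 3 → ℝ) :
    mdot (mcross x y) (mcross x y) = mdot x y ^ 2 - mdot x x * mdot y y := by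
  simp [mdot, mcross]; ring

theorem mdot_lcn_lp (lp lm : ℝ → Fin 3 → ℝ) (t : ℝ) : mdot (lcn lp lm t) (lp t) = 0 := by
  rw [lcn, mdot_smul_left, mdot_mcross_left, mul_zero]

theorem mdot_lcn_lm (lp lm : ℝ → Fin 3 → ℝ) (t : ℝ) : mdot (lcn lp lm t) (lm t) = 0 := by
  rw [lcn, mdot_smul_left, mdot_mcross_right, mul_zero]

theorem MemDelta4.mdot_lcn_self {lp lm : ℝ → Fin 3 → ℝ} {t : ℝ} (h : MemDelta4 (lp t) (lm t)) :
    mdot (lcn lp lm t) (lcn lp lm t) = 1 := by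
  rw [lcn, mdot_smul_left, mdot_comm, mdot_smul_left, mdot_mcross_self, h.2.2, h.1.2]
  norm_num

theorem LCstar.of_mdot_ne_zero {x y : Fin 3 → ℝ} (hx : mdot x x = 0) (hxy : mdot x y ≠ 0) :
    LCstar x :=
  ⟨fun h => hxy (by rw [h, mdot_zero_left]), hx⟩

/-- The pairs in `Δ₄` are preserved by the null rotations fixing `ℓ⁺`. -/
theorem MemDelta4.null_rotation {lp lm : ℝ → Fin 3 → ℝ} {t : ℝ} (h : MemDelta4 (lp t) (lm t))
    (k : ℝ) : MemDelta4 (lp t) (lm t + (2 * k) • lcn lp lm t + k ^ 2 • lp t) := by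
  have hnn := h.mdot_lcn_self
  have hnp := mdot_lcn_lp lp lm t
  have hnm := mdot_lcn_lm lp lm t
  obtain ⟨hp, hm, hpm⟩ := h
  have hpn := mdot_comm (lp t) (lcn lp lm t)
  have hmn := mdot_comm (lm t) (lcn lp lm t)
  have hmp := mdot_comm (lm t) (lp t)
  set v := lm t + (2 * k) • lcn lp lm t + k ^ 2 • lp t with hv
  have expand (x : Fin 3 → ℝ) :
      mdot v x = mdot (lm t) x + 2 * k * mdot (lcn lp lm t) x + k ^ 2 * mdot (lp t) x := by
    rw [hv, mdot_add_left, mdot_add_left, mdot_smul_left, mdot_smul_left]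
  have hvp : mdot v (lp t) = -2 := by
    rw [expand, hmp, hpm, hnp, hp.2]; ring
  have hvv : mdot v v = 0 := by
    rw [expand, mdot_comm (lm t), mdot_comm (lcn lp lm t), mdot_comm (lp t), expand, expand,
      expand, hm.2, hnm, hpm, hmn, hnm, hnn, hpn, hnp, hmp, hpm, hp.2]
    ring
  refine ⟨hp, LCstar.of_mdot_ne_zero hvv (y := lp t) (by rw [hvp]; norm_num), ?_⟩
  rw [mdot_comm, hvp]

theorem Smooth3.apply {I : Set ℝ} {f : ℝ → Fin 3 → ℝ} (hf : Smooth3 I f) (i : Fin 3) :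
    ContDiffOn ℝ (⊤ : ℕ∞) (fun t => f t i) I :=
  contDiffOn_pi.1 hf i

theorem Smooth3.lcn {I : Set ℝ} {lp lm : ℝ → Fin 3 → ℝ} (hp : Smooth3 I lp) (hm : Smooth3 I lm) :
    Smooth3 I (lcn lp lm) := by
  have h : Smooth3 I fun t => mcross (lp t) (lm t) := by
    refine contDiffOn_pi.2 fun i => ?_
    fin_cases i
    · exact (((hp.apply 1).mul (hm.apply 2)).sub ((hp.apply 2).mul (hm.apply 1))).neg
    · exact ((hp.apply 2).mul (hm.apply 0)).sub ((hp.apply 0).mul (hm.apply 2))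
    · exact ((hp.apply 0).mul (hm.apply 1)).sub ((hp.apply 1).mul (hm.apply 0))
  exact ContDiffOn.smul (contDiffOn_const (c := (-(1 / 2) : ℝ))) h

theorem Smooth3.mdot {I : Set ℝ} {f g : ℝ → Fin 3 → ℝ} (hf : Smooth3 I f) (hg : Smooth3 I g) :
    Smooth1 I (fun t => mdot (f t) (g t)) :=
  ((((hf.apply 0).mul (hg.apply 0)).neg.add ((hf.apply 1).mul (hg.apply 1))).add
    ((hf.apply 2).mul (hg.apply 2)))

/-- The derivative of `γ + λ ℓ⁺` in terms of the frame of `γ`. -/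
theorem HasLightconeCurvature.deriv_add_smul_lp {I : Set ℝ} (hIo : IsOpen I)
    {γ lp lm : ℝ → Fin 3 → ℝ} {κ₁ κ₂ κ₃ α β lam : ℝ → ℝ}
    (hF : IsLightconeFramedCurve I γ lp lm)
    (hC : HasLightconeCurvature I γ lp lm κ₁ κ₂ κ₃ α β) (hlam : Smooth1 I lam)
    {t : ℝ} (ht : t ∈ I) :
    deriv (fun s => γ s + lam s • lp s) t =
      (α t + deriv lam t + lam t * κ₁ t) • lp t + β t • lm t
        + (2 * (lam t * κ₃ t)) • lcn lp lm t := by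
  have hI := hIo.mem_nhds ht
  have hγ := ((hF.smooth_base.contDiffAt hI).differentiableAt (by simp)).hasDerivAt
  have hp := ((hF.smooth_lp.contDiffAt hI).differentiableAt (by simp)).hasDerivAt
  have hl := ((hlam.contDiffAt hI).differentiableAt (by simp)).hasDerivAt
  have h := (hγ.add (hl.smul hp)).deriv
  rw [hC.deriv_base t ht, hC.deriv_lp t ht] at h
  refine h.trans ?_
  module

/-- `(ℓ⁺,ℓ̄⁺)`-Bertrand lightcone framed curves: existence condition. -/
theorem bertrand_lp_lpbar
    (I : Set ℝ) (hIo : IsOpen I) (hIc : I.OrdConnected)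
    (γ lp lm : ℝ → Fin 3 → ℝ) (κ₁ κ₂ κ₃ α β : ℝ → ℝ)
    (hF : IsLightconeFramedCurve I γ lp lm)
    (hC : HasLightconeCurvature I γ lp lm κ₁ κ₂ κ₃ α β) :
    IsBertrand I fieldLp fieldLp γ lp lm ↔
      ∃ lam k : ℝ → ℝ, Smooth1 I lam ∧ Smooth1 I k ∧ NotIdentZero I lam ∧
        ∀ t ∈ I, k t * β t = lam t * κ₃ t := by
  constructor
  · rintro ⟨γ', lp', lm', -, hF', lam, hlam, hne, hγ', hlp'⟩
    refine ⟨lam, fun t => (1 / 2) * mdot (lm' t) (lcn lp lm t), hlam,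
      contDiffOn_const.mul (hF'.smooth_lm.mdot (hF.smooth_lp.lcn hF.smooth_lm)), hne,
      fun t ht => ?_⟩
    obtain ⟨α', β', -, -, hd⟩ := hF'.exists_coeffs
    have heq : γ' =ᶠ[nhds t] fun s => γ s + lam s • lp s :=
      Filter.eventuallyEq_of_mem (hIo.mem_nhds ht) hγ'
    have hlpt : lp t = lp' t := hlp' t ht
    have hD := heq.deriv_eq.symm.trans (hd t ht)
    rw [hC.deriv_add_smul_lp hIo hF hlam ht, ← hlpt] at hD
    have h4 := hF.delta4 t ht
    have h4' := hF'.delta4 t ht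
    have hp := congrArg (fun x => mdot x (lp t)) hD
    have hn := congrArg (fun x => mdot x (lcn lp lm t)) hD
    simp only [mdot_add_left, mdot_smul_left] at hp hn
    rw [h4.1.2, mdot_lcn_lp, mdot_comm (lm t), h4.2.2, mdot_comm (lm' t), hlpt, h4'.2.2] at hp
    rw [h4.mdot_lcn_self, mdot_comm (lp t), mdot_lcn_lp, mdot_comm (lm t), mdot_lcn_lm] at hn
    have hβ : β t = β' t := by linarith
    rw [hβ]
    linarith
  · rintro ⟨lam, k, hlam, hk, hne, hkβ⟩
    have hp := hF.smooth_lp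
    have hm := hF.smooth_lm
    refine ⟨fun t => γ t + lam t • lp t, lp,
      fun t => lm t + (2 * k t) • lcn lp lm t + k t ^ 2 • lp t, hF, ?_, lam, hlam, hne,
      fun _ _ => rfl, fun _ _ => rfl⟩
    refine ⟨hF.smooth_base.add (hlam.smul hp), hp,
      (hm.add ((contDiffOn_const.mul hk).smul (hp.lcn hm))).add ((hk.pow 2).smul hp),
      fun t ht => (hF.delta4 t ht).null_rotation (k t),
      fun t => α t + deriv lam t + lam t * κ₁ t - β t * k t ^ 2, β, ?_, hC.smooth_β,
      fun t ht => ?_⟩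
    · exact ((hC.smooth_α.add (hlam.deriv_of_isOpen hIo (by simp))).add
        (hlam.mul hC.smooth_κ₁)).sub (hC.smooth_β.mul (hk.pow 2))
    · rw [hC.deriv_add_smul_lp hIo hF hlam ht, ← hkβ t ht]
      module
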